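/- Let Υ ⊆ Δ be a spanning i-forest such that the natural surjection H̃_{i−1}(Υ) → H̃_{i−1}(Δ) is an isomorphism. Let Θ = Δ_i \ Υ_i and let L̃ : ℤΘ → ℤΘ be the reduced Laplacian, the square submatrix of L_i consisting of the rows and columns indexed by Θ. Then the map obtained by setting the coordinates indexed by faces of Υ_i equal to 0 induces an isomorphism crit_i(Δ) ≅ ℤΘ / im L̃. -/

import Mathlib

open Finset Matrix

/-- A finite abstract simplicial complex on the vertex set `Fin n`: a collection of
finite subsets of `Fin n` (its faces) closed under taking subsets. -/
structure SComplex (n : ℕ) where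
  faces : Finset (Finset (Fin n))
  down_closed : ∀ s ∈ faces, ∀ t ⊆ s, t ∈ faces

namespace SComplex

variable {n : ℕ} (Δ : SComplex n)

/-- The faces of cardinality `k`, i.e. the `(k-1)`-dimensional faces. -/
def Faces (k : ℕ) : Finset (Finset (Fin n)) :=
  Δ.faces.filter fun f => f.card = k

/-- The group of `(k-1)`-dimensional chains: formal `ℤ`-linear combinations of the
faces of cardinality `k`.  (So `Chain 0` plays the role of `C_{-1}(Δ) ≅ ℤ`, generated
by the empty face, and `Chain (i+1)` is the group `C_i(Δ)` of `i`-dimensional chains.) -/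
abbrev Chain (k : ℕ) : Type := {f // f ∈ Δ.Faces k} → ℤ

/-- The sign `(-1)^j` with which the subface `g` (obtained from `f` by deleting its
`j`-th smallest vertex) occurs in the boundary of `f`; `0` if `g` is not a
codimension-one subface of `f`. -/
def bcoef (f g : Finset (Fin n)) : ℤ :=
  if g ⊆ f ∧ f.card = g.card + 1 then
    ∑ v ∈ f \ g, (-1 : ℤ) ^ (f.filter (fun x => x < v)).card
  else 0

/-- The matrix (in the standard bases, with the standard orientation) of the boundary
map from chains on faces of cardinality `k+1` to chains on faces of cardinality `k`. -/
def B (k : ℕ) : Matrix {f // f ∈ Δ.Faces k} {f // f ∈ Δ.Faces (k + 1)} ℤ :=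
  fun g f => bcoef (f : Finset (Fin n)) (g : Finset (Fin n))

/-- The simplicial boundary map `∂_k : C_k(Δ) → C_{k-1}(Δ)` (standard orientation),
as a map `Chain (k+1) → Chain k`.  For `k = 0` this is the reduced boundary map into
`C_{-1}(Δ) ≅ ℤ`. -/
noncomputable def bdry (k : ℕ) : Δ.Chain (k + 1) →ₗ[ℤ] Δ.Chain k :=
  (Δ.B k).mulVecLin

/-- The transpose `∂_kᵗ` of the boundary map. -/
noncomputable def tbdry (k : ℕ) : Δ.Chain k →ₗ[ℤ] Δ.Chain (k + 1) :=
  ((Δ.B k)ᵀ).mulVecLin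

/-- The matrix of the `i`-th (up-down combinatorial) Laplacian. -/
def LapM (i : ℕ) : Matrix {f // f ∈ Δ.Faces (i + 1)} {f // f ∈ Δ.Faces (i + 1)} ℤ :=
  Δ.B (i + 1) * (Δ.B (i + 1))ᵀ

/-- The `i`-th Laplacian `L_i = ∂_{i+1} ∘ ∂_{i+1}ᵗ` on `i`-dimensional chains. -/
noncomputable def Lap (i : ℕ) : Δ.Chain (i + 1) →ₗ[ℤ] Δ.Chain (i + 1) :=
  (Δ.LapM i).mulVecLin

/-- A chain is effective if all of its coefficients are nonnegative. -/
def Effective {k : ℕ} (σ : Δ.Chain k) : Prop := ∀ f, 0 ≤ σ f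

/-- `σ·h = Σ_f σ(f)h(f)`. -/
def dot {k : ℕ} (σ h : Δ.Chain k) : ℤ := ∑ f, σ f * h f

/-- The `i`-th nonnegative kernel `ker⁺L_i`: effective `i`-chains in `ker L_i`. -/
def kerPlus (i : ℕ) : Set (Δ.Chain (i + 1)) :=
  {τ | Δ.Lap i τ = 0 ∧ Δ.Effective τ}

/-- Two `i`-chains are linearly equivalent if their difference lies in `im L_i`. -/
def LinEquiv (i : ℕ) (σ σ' : Δ.Chain (i + 1)) : Prop :=
  σ' - σ ∈ LinearMap.range (Δ.Lap i)

/-- An `i`-chain is winnable if it is linearly equivalent to an effective `i`-chain. -/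
def Winnable (i : ℕ) (σ : Δ.Chain (i + 1)) : Prop :=
  ∃ σ', Δ.Effective σ' ∧ Δ.LinEquiv i σ σ'

/-- The Hilbert basis of `ker⁺L_i`: its nonzero elements that are not the sum of two
nonzero elements of `ker⁺L_i`. -/
def hilbBasis (i : ℕ) : Set (Δ.Chain (i + 1)) :=
  {τ | τ ∈ Δ.kerPlus i ∧ τ ≠ 0 ∧
    ¬ ∃ a ∈ Δ.kerPlus i, ∃ b ∈ Δ.kerPlus i, a ≠ 0 ∧ b ≠ 0 ∧ τ = a + b}

/-- The cycles among the chains on faces of cardinality `k`: the kernel of the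
(reduced) boundary map `∂_{k-1}`.  For `k = 0` (the `(-1)`-chains, where the boundary
map is zero) every chain is a cycle. -/
noncomputable def cycles : (k : ℕ) → Submodule ℤ (Δ.Chain k)
  | 0 => ⊤
  | (k + 1) => LinearMap.ker (Δ.bdry k)

/-- The image of the `i`-th Laplacian, viewed inside the `i`-cycles. -/
noncomputable def critSub (i : ℕ) : Submodule ℤ ↥(Δ.cycles (i + 1)) :=
  Submodule.comap (Δ.cycles (i + 1)).subtype (LinearMap.range (Δ.Lap i))

/-- The `i`-th critical group `crit_i(Δ) = ker ∂_i / im L_i`. -/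
noncomputable abbrev Crit (i : ℕ) : Type :=
  ↥(Δ.cycles (i + 1)) ⧸ Δ.critSub i

/-- The image of the boundary map `∂_k`, viewed inside the cycles `cycles k`. -/
noncomputable def bdrySub (k : ℕ) : Submodule ℤ ↥(Δ.cycles k) :=
  Submodule.comap (Δ.cycles k).subtype (LinearMap.range (Δ.bdry k))

/-- The reduced homology group `H̃_{k-1}(Δ) = ker ∂_{k-1} / im ∂_k` (so the `i`-th
reduced homology group of `Δ` is `RedHomologyAt (i+1)`). -/
noncomputable abbrev RedHomologyAt (k : ℕ) : Type :=
  ↥(Δ.cycles k) ⧸ Δ.bdrySub k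

/-- The orthogonal complement `(ker L_i)^⊥` of `ker L_i` in the `i`-chains. -/
def kerPerp (i : ℕ) : Submodule ℤ (Δ.Chain (i + 1)) where
  carrier := {σ | ∀ τ ∈ LinearMap.ker (Δ.Lap i), Δ.dot σ τ = 0}
  add_mem' := by
    intro a b ha hb τ hτ
    have h : Δ.dot (a + b) τ = Δ.dot a τ + Δ.dot b τ := by
      simp [dot, Pi.add_apply, add_mul, Finset.sum_add_distrib]
    rw [h, ha τ hτ, hb τ hτ, add_zero]
  zero_mem' := by
    intro τ hτ
    simp [dot]
  smul_mem' := by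
    intro c a ha τ hτ
    have h : Δ.dot (c • a) τ = c * Δ.dot a τ := by
      simp [dot, Pi.smul_apply, Finset.mul_sum, mul_assoc]
    rw [h, ha τ hτ, mul_zero]

/-! ### Pseudomanifolds -/

/-- `Δ` is a pseudomanifold of dimension `d` (the facets are the faces of
cardinality `d+1`): it is pure, non-branching, and strongly connected. -/
def IsPseudomanifold (d : ℕ) : Prop :=
  (∀ f ∈ Δ.faces, ∃ g ∈ Δ.Faces (d + 1), f ⊆ g) ∧
  (∀ g ∈ Δ.Faces d, ((Δ.Faces (d + 1)).filter fun f => g ⊆ f).card ≤ 2) ∧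
  (∀ f ∈ Δ.Faces (d + 1), ∀ f' ∈ Δ.Faces (d + 1),
    Relation.ReflTransGen
      (fun a b => a ∈ Δ.Faces (d + 1) ∧ b ∈ Δ.Faces (d + 1) ∧ (a ∩ b).card = d) f f')

/-- The boundary `∂Δ` of a `d`-dimensional pseudomanifold: the `(d-1)`-faces contained
in exactly one facet. -/
def pmBoundary (d : ℕ) : Finset (Finset (Fin n)) :=
  (Δ.Faces d).filter fun g => ((Δ.Faces (d + 1)).filter fun f => g ⊆ f).card = 1

/-- A pseudomanifold orientation for a `d`-dimensional pseudomanifold: a top chain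
`γ` with all coefficients `±1` whose boundary is supported on `∂Δ`. -/
noncomputable def IsOrientation (d : ℕ) (γ : Δ.Chain (d + 1)) : Prop :=
  (∀ f, γ f = 1 ∨ γ f = -1) ∧
  (∀ g : {f // f ∈ Δ.Faces d},
    (g : Finset (Fin n)) ∉ Δ.pmBoundary d → Δ.bdry d γ g = 0)

/-- `γ_j` as a top-dimensional chain, for a vertex `j` of the `γ`-incidence graph:
the extra vertex `γ_0 = 0` is encoded by `none`, and the oriented facet `γ_f` by
`some f`. -/
noncomputable def gammaInd (D : ℕ) (γ : Δ.Chain (D + 1)) :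
    Option {f // f ∈ Δ.Faces (D + 1)} → Δ.Chain (D + 1)
  | none => 0
  | some f => Pi.single f (γ f)

/-- The edge of the `γ`-incidence graph corresponding to the `(D-1)`-dimensional face
`σ` goes from the vertex `a` to the vertex `b`: this means `∂ᵗ(σ) = γ_b - γ_a`. -/
noncomputable def edgeFromTo (D : ℕ) (γ : Δ.Chain (D + 1)) (σ : {f // f ∈ Δ.Faces D})
    (a b : Option {f // f ∈ Δ.Faces (D + 1)}) : Prop :=
  Δ.tbdry D (Pi.single σ 1) = Δ.gammaInd D γ b - Δ.gammaInd D γ a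

/-- `τ` is the incidence vector of a simple directed cycle of the `γ`-incidence graph
`Γ(Δ,γ)`: there is a closed directed walk with pairwise distinct vertices and pairwise
distinct edges whose edge labels sum to `τ`. -/
noncomputable def IsCycleVector (D : ℕ) (γ : Δ.Chain (D + 1)) (τ : Δ.Chain D) : Prop :=
  ∃ (k : ℕ) (hk : 0 < k) (v : Fin k → Option {f // f ∈ Δ.Faces (D + 1)})
    (e : Fin k → {f // f ∈ Δ.Faces D}),
    Function.Injective v ∧ Function.Injective e ∧
    (∀ t : Fin k, Δ.edgeFromTo D γ (e t) (v t) (v ⟨(t.1 + 1) % k, Nat.mod_lt _ hk⟩)) ∧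
    τ = ∑ t : Fin k, Pi.single (e t) (1 : ℤ)

/-! ### Spanning forests -/

/-- The chains supported on a set `F` of faces. -/
def suppIn (k : ℕ) (F : Finset (Finset (Fin n))) : Submodule ℤ (Δ.Chain k) where
  carrier := {σ | ∀ f : {f // f ∈ Δ.Faces k}, (f : Finset (Fin n)) ∉ F → σ f = 0}
  add_mem' := by
    intro a b ha hb f hf
    simp [Pi.add_apply, ha f hf, hb f hf]
  zero_mem' := by intro f hf; rfl
  smul_mem' := by
    intro c a ha f hf
    simp [Pi.smul_apply, ha f hf]

/-- The reduced homology group `H̃_{i-1}(Υ)` of the subcomplex `Υ` with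
`Skel_{i-1}(Υ) = Skel_{i-1}(Δ)` and with set of `i`-faces `F`: namely
`ker ∂_{i-1} / ∂_i(chains supported on F)`. -/
noncomputable abbrev forestHom (i : ℕ) (F : Finset (Finset (Fin n))) : Type :=
  ↥(Δ.cycles i) ⧸ Submodule.comap (Δ.cycles i).subtype
      (Submodule.map (Δ.bdry i) (Δ.suppIn (i + 1) F))

/-- `F ⊆ Δ_i` encodes a spanning `i`-forest of `Δ`: the `i`-dimensional subcomplex
`Υ` with `Skel_{i-1}(Υ) = Skel_{i-1}(Δ)` and with `i`-faces `F`, subject to: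
`H̃_i(Υ) = 0`; `β̃_{i-1}(Υ) = β̃_{i-1}(Δ)`; and `|Υ_i| = |Δ_i| - β̃_i(Skel_i(Δ))`
(note `H̃_i(Skel_i(Δ)) = ker ∂_i` since `Skel_i(Δ)` has no `(i+1)`-faces). -/
noncomputable def IsSpanningForest (i : ℕ) (F : Finset (Finset (Fin n))) : Prop :=
  F ⊆ Δ.Faces (i + 1) ∧
  (∀ σ ∈ Δ.suppIn (i + 1) F, Δ.bdry i σ = 0 → σ = 0) ∧
  Module.finrank ℤ (Δ.forestHom i F) = Module.finrank ℤ (Δ.RedHomologyAt i) ∧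
  F.card = (Δ.Faces (i + 1)).card - Module.finrank ℤ ↥(Δ.cycles (i + 1))

open scoped Classical in
/-- The `i`-forest number `τ_i(Δ) = Σ_Υ |T(H̃_{i-1}(Υ))|²`, the sum over all spanning
`i`-forests of `Δ`. -/
noncomputable def forestNumber (i : ℕ) : ℕ :=
  ∑ F ∈ (Δ.Faces (i + 1)).powerset.filter (fun F => Δ.IsSpanningForest i F),
    (Nat.card ↥(Submodule.torsion ℤ (Δ.forestHom i F))) ^ 2

/-- Restriction of chains to the coordinates indexed by a subset `Θ` of the faces
(i.e. setting the remaining coordinates to `0`). -/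
noncomputable def restrictTo (k : ℕ) (Θ : Finset (Finset (Fin n)))
    (hΘ : Θ ⊆ Δ.Faces k) : Δ.Chain k →ₗ[ℤ] ({f // f ∈ Θ} → ℤ) where
  toFun σ := fun a => σ ⟨a.1, hΘ a.2⟩
  map_add' := by intros; rfl
  map_smul' := by intros; rfl

/-- The reduced Laplacian: the square submatrix of `L_i` consisting of the rows
and columns indexed by `Θ`, as a linear map `ℤΘ → ℤΘ`. -/
noncomputable def redLap (i : ℕ) (Θ : Finset (Finset (Fin n)))
    (hΘ : Θ ⊆ Δ.Faces (i + 1)) : ({f // f ∈ Θ} → ℤ) →ₗ[ℤ] ({f // f ∈ Θ} → ℤ) :=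
  (Matrix.of fun a b : {f // f ∈ Θ} =>
    Δ.LapM i ⟨a.1, hΘ a.2⟩ ⟨b.1, hΘ b.2⟩).mulVecLin

end SComplex

namespace SComplex

variable {n : ℕ} (Δ : SComplex n)

lemma bcoef_insert {a : Fin n} {h : Finset (Fin n)} (ha : a ∉ h) :
    bcoef (insert a h) h = (-1) ^ (h.filter (· < a)).card := by
  have hcard : (insert a h).card = h.card + 1 := card_insert_of_notMem ha
  have hsdiff : insert a h \ h = {a} := by
    ext x
    simp only [mem_sdiff, mem_insert, mem_singleton]
    grind
  rw [bcoef, if_pos ⟨subset_insert a h, hcard⟩, hsdiff, sum_singleton, filter_insert,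
    if_neg (lt_irrefl a)]

lemma bcoef_eq_zero_of_not_subset {f g : Finset (Fin n)} (h : ¬ g ⊆ f) : bcoef f g = 0 :=
  if_neg fun h' => h h'.1

/-- The two ways of deleting `a` and `b` in turn occur with opposite signs. -/
lemma bcoef_insert_insert {a b : Fin n} {h : Finset (Fin n)} (ha : a ∉ h) (hb : b ∉ h)
    (hab : a < b) :
    bcoef (insert a h) h * bcoef (insert b (insert a h)) (insert a h) +
      bcoef (insert b h) h * bcoef (insert b (insert a h)) (insert b h) = 0 := by
  have hb' : b ∉ insert a h := by simp [hab.ne', hb]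
  have ha' : a ∉ insert b h := by simp [hab.ne, ha]
  have ha'' : a ∉ h.filter (· < b) := fun hmem => ha (mem_filter.mp hmem).1
  rw [bcoef_insert ha, bcoef_insert hb, bcoef_insert hb', Finset.insert_comm b a h,
    bcoef_insert ha', filter_insert, if_pos hab, filter_insert, if_neg hab.not_gt,
    card_insert_of_notMem ha'']
  ring

theorem B_mul_B (k : ℕ) : Δ.B k * Δ.B (k + 1) = 0 := by
  ext ⟨h, hh⟩ ⟨g, hg⟩
  obtain ⟨-, hhc⟩ := mem_filter.mp hh
  obtain ⟨hgΔ, hgc⟩ := mem_filter.mp hg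
  simp only [Matrix.mul_apply, B, Matrix.zero_apply]
  rw [Finset.sum_coe_sort (Δ.Faces (k + 1)) fun f => bcoef f h * bcoef g f]
  by_cases hsub : h ⊆ g
  · obtain ⟨a, b, hab, hdiff⟩ : ∃ a b, a < b ∧ g \ h = {a, b} := by
      have hcard : (g \ h).card = 2 := by
        rw [card_sdiff_of_subset hsub]
        omega
      obtain ⟨x, y, hxy, hd⟩ := card_eq_two.mp hcard
      rcases lt_or_gt_of_ne hxy with hlt | hlt
      · exact ⟨x, y, hlt, hd⟩
      · exact ⟨y, x, hlt, by rw [hd, pair_comm]⟩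
    have ha : a ∈ g \ h := by simp [hdiff]
    have hb : b ∈ g \ h := by simp [hdiff]
    obtain ⟨-, ha⟩ := mem_sdiff.mp ha
    obtain ⟨-, hb⟩ := mem_sdiff.mp hb
    have hg_eq : g = insert b (insert a h) := by
      rw [← union_sdiff_of_subset hsub, hdiff]
      ext x
      simp only [mem_union, mem_insert, mem_singleton]
      tauto
    have hne : insert a h ≠ insert b h := by
      intro heq
      have : a ∈ insert b h := heq ▸ mem_insert_self a h
      simp [hab.ne, ha] at this
    have hpair : ({insert a h, insert b h} : Finset (Finset (Fin n))) ⊆ Δ.Faces (k + 1) := by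
      intro f hf
      simp only [mem_insert, mem_singleton] at hf
      refine mem_filter.mpr ⟨Δ.down_closed g hgΔ f ?_, ?_⟩
      · subst hg_eq
        rcases hf with rfl | rfl
        · exact subset_insert _ _
        · exact insert_subset_insert _ (subset_insert _ _)
      · rcases hf with rfl | rfl
        · rw [card_insert_of_notMem ha, hhc]
        · rw [card_insert_of_notMem hb, hhc]
    rw [← sum_subset hpair, sum_pair hne, hg_eq]
    · exact bcoef_insert_insert ha hb hab
    · intro f hf hf'
      obtain ⟨-, hfc⟩ := mem_filter.mp hf
      by_cases hhf : h ⊆ f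
      · by_cases hfg : f ⊆ g
        · refine absurd ?_ hf'
          obtain ⟨v, hv⟩ := card_eq_one.mp
            (show (f \ h).card = 1 by rw [card_sdiff_of_subset hhf]; omega)
          have hf_eq : f = insert v h := by
            rw [← union_sdiff_of_subset hhf, hv, union_comm, insert_eq]
          have hvg : v ∈ g \ h := sdiff_subset_sdiff hfg subset_rfl (by simp [hv])
          rw [hdiff, mem_insert, mem_singleton] at hvg
          rcases hvg with rfl | rfl <;> simp [hf_eq]
        · rw [bcoef_eq_zero_of_not_subset hfg, mul_zero]
      · rw [bcoef_eq_zero_of_not_subset hhf, zero_mul]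
  · refine sum_eq_zero fun f _ => ?_
    by_cases hhf : h ⊆ f
    · rw [bcoef_eq_zero_of_not_subset fun hfg => hsub (hhf.trans hfg), mul_zero]
    · rw [bcoef_eq_zero_of_not_subset hhf, zero_mul]

theorem bdry_mem_cycles (k : ℕ) (σ : Δ.Chain (k + 1)) : Δ.bdry k σ ∈ Δ.cycles k := by
  cases k with
  | zero => trivial
  | succ k =>
    change (Δ.B k).mulVec ((Δ.B (k + 1)).mulVec σ) = 0
    rw [Matrix.mulVec_mulVec, B_mul_B, Matrix.zero_mulVec]

theorem Lap_apply (i : ℕ) (σ : Δ.Chain (i + 1)) :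
    Δ.Lap i σ = Δ.bdry (i + 1) (Δ.tbdry (i + 1) σ) :=
  (Matrix.mulVec_mulVec σ (Δ.B (i + 1)) (Δ.B (i + 1))ᵀ).symm

theorem Lap_mem_cycles (i : ℕ) (σ : Δ.Chain (i + 1)) : Δ.Lap i σ ∈ Δ.cycles (i + 1) := by
  rw [Lap_apply]
  exact Δ.bdry_mem_cycles (i + 1) _

/-- A chain orthogonal to all cycles is killed by the coboundary map. -/
theorem tbdry_eq_zero_of_orthogonal {k : ℕ} {σ : Δ.Chain k}
    (h : ∀ z ∈ Δ.cycles k, σ ⬝ᵥ z = 0) : Δ.tbdry k σ = 0 := by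
  refine dotProduct_eq_zero _ fun w => ?_
  change (Δ.B k)ᵀ.mulVec σ ⬝ᵥ w = 0
  rw [Matrix.mulVec_transpose, ← Matrix.dotProduct_mulVec]
  exact h _ (Δ.bdry_mem_cycles k w)

section Restriction

variable {k : ℕ} {Θ : Finset (Finset (Fin n))} (hΘ : Θ ⊆ Δ.Faces k)

/-- Extension by zero of a chain supported on `Θ`. -/
def extendFrom (k : ℕ) (θ : {f // f ∈ Θ} → ℤ) : Δ.Chain k :=
  fun f => if hf : f.1 ∈ Θ then θ ⟨f.1, hf⟩ else 0

@[simp]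
theorem restrictTo_extendFrom (θ : {f // f ∈ Θ} → ℤ) :
    Δ.restrictTo k Θ hΘ (Δ.extendFrom k θ) = θ := by
  funext a
  exact dif_pos a.2

theorem dotProduct_extendFrom (θ : {f // f ∈ Θ} → ℤ) (c : Δ.Chain k) :
    c ⬝ᵥ Δ.extendFrom k θ = Δ.restrictTo k Θ hΘ c ⬝ᵥ θ := by
  classical
  simp only [dotProduct]
  symm
  refine sum_of_injOn (fun a : {f // f ∈ Θ} => (⟨a.1, hΘ a.2⟩ : {f // f ∈ Δ.Faces k}))
    ?_ (fun _ _ => mem_coe.mpr (mem_univ _)) ?_ ?_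
  · intro a _ b _ hab
    exact Subtype.ext (congrArg (fun f : {f // f ∈ Δ.Faces k} => f.1) hab)
  · intro f _ hf
    have : f.1 ∉ Θ := fun hmem => hf ⟨⟨f.1, hmem⟩, by simp, rfl⟩
    simp [extendFrom, this]
  · intro a _
    simp [extendFrom, restrictTo]

end Restriction

theorem redLap_apply (i : ℕ) {Θ : Finset (Finset (Fin n))} (hΘ : Θ ⊆ Δ.Faces (i + 1))
    (θ : {f // f ∈ Θ} → ℤ) :
    Δ.redLap i Θ hΘ θ = Δ.restrictTo (i + 1) Θ hΘ (Δ.Lap i (Δ.extendFrom (i + 1) θ)) := by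
  funext a
  exact (Δ.dotProduct_extendFrom hΘ θ (Δ.LapM i ⟨a.1, hΘ a.2⟩)).symm

/-- If restriction to `Θ` is bijective on cycles, the image of the Laplacian is already
attained on chains supported on `Θ`. -/
theorem exists_Lap_extendFrom_eq (i : ℕ) {Θ : Finset (Finset (Fin n))}
    (hΘ : Θ ⊆ Δ.Faces (i + 1))
    (hbij : Function.Bijective (Δ.restrictTo (i + 1) Θ hΘ ∘ₗ (Δ.cycles (i + 1)).subtype))
    (σ : Δ.Chain (i + 1)) :
    ∃ θ : {f // f ∈ Θ} → ℤ, Δ.Lap i (Δ.extendFrom (i + 1) θ) = Δ.Lap i σ := by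
  classical
  let e := LinearEquiv.ofBijective _ hbij
  let ℓ : ({f // f ∈ Θ} → ℤ) →ₗ[ℤ] ℤ :=
    dotProductBilin ℤ ℤ σ ∘ₗ (Δ.cycles (i + 1)).subtype ∘ₗ e.symm.toLinearMap
  obtain ⟨θ, hθ⟩ := (dotProductEquiv ℤ {f // f ∈ Θ}).surjective ℓ
  refine ⟨θ, ?_⟩
  rw [Lap_apply, Lap_apply]
  congr 1
  rw [← sub_eq_zero, ← map_sub]
  refine Δ.tbdry_eq_zero_of_orthogonal fun z hz => ?_
  have h1 : θ ⬝ᵥ e ⟨z, hz⟩ = σ ⬝ᵥ (e.symm (e ⟨z, hz⟩)).1 :=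
    LinearMap.congr_fun hθ (e ⟨z, hz⟩)
  rw [e.symm_apply_apply] at h1
  rw [sub_dotProduct, dotProduct_comm, Δ.dotProduct_extendFrom hΘ, dotProduct_comm, sub_eq_zero]
  exact h1

/-- The boundary group of `Δ` is spanned by the faces of a forest `Υ` as soon as
`H̃_{i-1}(Υ) → H̃_{i-1}(Δ)` is injective. -/
theorem exists_suppIn_bdry_eq (i : ℕ) (F : Finset (Finset (Fin n)))
    (hiso : ∀ (h : Submodule.comap (Δ.cycles i).subtype
          (Submodule.map (Δ.bdry i) (Δ.suppIn (i + 1) F)) ≤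
        Submodule.comap LinearMap.id (Δ.bdrySub i)),
      Function.Injective (Submodule.mapQ
        (Submodule.comap (Δ.cycles i).subtype
          (Submodule.map (Δ.bdry i) (Δ.suppIn (i + 1) F)))
        (Δ.bdrySub i) LinearMap.id h))
    (σ : Δ.Chain (i + 1)) : ∃ τ ∈ Δ.suppIn (i + 1) F, Δ.bdry i τ = Δ.bdry i σ := by
  have hle : Submodule.comap (Δ.cycles i).subtype
      (Submodule.map (Δ.bdry i) (Δ.suppIn (i + 1) F)) ≤
        Submodule.comap LinearMap.id (Δ.bdrySub i) := by
    rintro x ⟨τ, -, hτ⟩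
    exact ⟨τ, hτ⟩
  let z : Δ.cycles i := ⟨Δ.bdry i σ, Δ.bdry_mem_cycles i σ⟩
  have hz : Submodule.Quotient.mk (p := Submodule.comap (Δ.cycles i).subtype
      (Submodule.map (Δ.bdry i) (Δ.suppIn (i + 1) F))) z = 0 := by
    refine hiso hle ?_
    rw [map_zero, Submodule.mapQ_apply, Submodule.Quotient.mk_eq_zero]
    exact ⟨σ, rfl⟩
  rw [Submodule.Quotient.mk_eq_zero] at hz
  exact hz

/-- The cycles restrict isomorphically to the complement of a set `F` of faces that supports
no nonzero cycle and spans all boundaries. -/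
theorem restrictTo_cycles_bijective (i : ℕ) (F : Finset (Finset (Fin n)))
    (hindep : ∀ σ ∈ Δ.suppIn (i + 1) F, Δ.bdry i σ = 0 → σ = 0)
    (hspan : ∀ σ, ∃ τ ∈ Δ.suppIn (i + 1) F, Δ.bdry i τ = Δ.bdry i σ) :
    Function.Bijective (Δ.restrictTo (i + 1) (Δ.Faces (i + 1) \ F) Finset.sdiff_subset ∘ₗ
      (Δ.cycles (i + 1)).subtype) := by
  constructor
  · refine (injective_iff_map_eq_zero _).mpr fun z hz => Subtype.ext ?_
    refine hindep z.1 (fun f hf => ?_) z.2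
    exact congrFun hz ⟨f.1, mem_sdiff.mpr ⟨f.2, hf⟩⟩
  · intro θ
    obtain ⟨τ, hτ, hb⟩ := hspan (Δ.extendFrom (i + 1) θ)
    refine ⟨⟨Δ.extendFrom (i + 1) θ - τ, ?_⟩, ?_⟩
    · change Δ.bdry i _ = 0
      rw [map_sub, hb, sub_self]
    · change Δ.restrictTo _ _ Finset.sdiff_subset (Δ.extendFrom (i + 1) θ - τ) = θ
      rw [map_sub, restrictTo_extendFrom, sub_eq_self]
      funext a
      exact hτ _ (mem_sdiff.mp a.2).2

end SComplex

/-- Let `F` encode a spanning `i`-forest `Υ` of `Δ` such that the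
natural surjection `H̃_{i-1}(Υ) → H̃_{i-1}(Δ)` is an isomorphism.  Let
`Θ = Δ_i \ Υ_i`, and let `L̃` be the reduced Laplacian (the square submatrix of `L_i`
with rows and columns indexed by `Θ`).  Then setting the coordinates indexed by `Υ_i`
equal to `0` induces an isomorphism `crit_i(Δ) ≅ ℤΘ / im L̃`. -/
theorem reduced_laplacian_iso {n : ℕ} (Δ : SComplex n) (i : ℕ)
    (F : Finset (Finset (Fin n)))
    (hF : Δ.IsSpanningForest i F)
    (hiso : ∀ (h : Submodule.comap (Δ.cycles i).subtype
          (Submodule.map (Δ.bdry i) (Δ.suppIn (i + 1) F)) ≤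
        Submodule.comap LinearMap.id (Δ.bdrySub i)),
      Function.Bijective (Submodule.mapQ
        (Submodule.comap (Δ.cycles i).subtype
          (Submodule.map (Δ.bdry i) (Δ.suppIn (i + 1) F)))
        (Δ.bdrySub i) LinearMap.id h)) :
    ∀ (φ : ↥(Δ.cycles (i + 1)) →ₗ[ℤ]
        (({f // f ∈ Δ.Faces (i + 1) \ F} → ℤ) ⧸
          LinearMap.range (Δ.redLap i (Δ.Faces (i + 1) \ F) Finset.sdiff_subset))),
      φ = (LinearMap.range
            (Δ.redLap i (Δ.Faces (i + 1) \ F) Finset.sdiff_subset)).mkQ ∘ₗ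
          Δ.restrictTo (i + 1) (Δ.Faces (i + 1) \ F) Finset.sdiff_subset ∘ₗ
          (Δ.cycles (i + 1)).subtype →
      Δ.critSub i ≤ LinearMap.ker φ ∧
      ∀ (h : Δ.critSub i ≤ LinearMap.ker φ),
        Function.Bijective (Submodule.liftQ (Δ.critSub i) φ h) := by
  rintro φ rfl
  set Θ := Δ.Faces (i + 1) \ F
  have hΘ : Θ ⊆ Δ.Faces (i + 1) := Finset.sdiff_subset
  have hbij := Δ.restrictTo_cycles_bijective i F hF.2.1
    (Δ.exists_suppIn_bdry_eq i F fun h => (hiso h).1)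
  refine ⟨?_, fun h => ⟨?_, ?_⟩⟩
  · rintro z ⟨σ, hσ⟩
    obtain ⟨θ, hθ⟩ := Δ.exists_Lap_extendFrom_eq i hΘ hbij σ
    refine (Submodule.Quotient.mk_eq_zero _).mpr ⟨θ, ?_⟩
    rw [Δ.redLap_apply, hθ, hσ]
    rfl
  · refine (injective_iff_map_eq_zero _).mpr fun q hq => ?_
    obtain ⟨z, rfl⟩ := Submodule.Quotient.mk_surjective _ q
    obtain ⟨θ, hθ⟩ := (Submodule.Quotient.mk_eq_zero _).mp hq
    rw [Δ.redLap_apply] at hθ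
    have hz : (⟨_, Δ.Lap_mem_cycles i (Δ.extendFrom (i + 1) θ)⟩ : Δ.cycles (i + 1)) = z :=
      hbij.1 hθ
    exact (Submodule.Quotient.mk_eq_zero _).mpr ⟨_, congrArg Subtype.val hz⟩
  · intro q
    obtain ⟨θ, rfl⟩ := Submodule.Quotient.mk_surjective _ q
    obtain ⟨z, hz⟩ := hbij.2 θ
    exact ⟨Submodule.Quotient.mk z, congrArg (Submodule.Quotient.mk) hz⟩
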